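/- Let (a_n)_{n≥1} and (b_n)_{n≥1} be sequences of positive integers such that a_n ≤ α n^l and β₁ n^{k₁} ≤ b_n ≤ β₂ n^{k₂} for all n ≥ 1, where l is a non-negative real number and α, β₁, β₂, k₁, k₂ are positive real numbers satisfying l < k₁ ≤ k₂. Then the generalized continued fraction K_{n=1}^∞ a_n/b_n converges to an irrational number τ, and μ_I(τ) ≤ 2 + l/(k₁ − l). -/

import Mathlib

open Filter Real

/-- The asymptotic irrationality exponent: the infimum (in `EReal`, so that the
infimum of the empty set is `∞`) of all real `μ` for which there exist `c > 0`
and `N₀ > 0` with `|τ - M/N| ≥ c / N ^ μ` for all integers `M, N` with `N ≥ N₀`. -/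
noncomputable def muI (τ : ℝ) : EReal :=
  sInf ((fun μ : ℝ => (μ : EReal)) ''
    {μ : ℝ | ∃ c > (0:ℝ), ∃ N₀ > (0:ℝ), ∀ M N : ℤ,
      (N : ℝ) ≥ N₀ → |τ - (M : ℝ) / (N : ℝ)| ≥ c / (N : ℝ) ^ μ})

/-- Numerators of the convergents of the generalized continued fraction
`K_{n=1}^∞ a n / b n`. -/
def cfA (a b : ℕ → ℤ) : ℕ → ℤ
  | 0 => 0
  | 1 => a 1
  | (n + 2) => b (n + 2) * cfA a b (n + 1) + a (n + 2) * cfA a b n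

/-- Denominators of the convergents of the generalized continued fraction
`K_{n=1}^∞ a n / b n`. -/
def cfB (a b : ℕ → ℤ) : ℕ → ℤ
  | 0 => 1
  | 1 => b 1
  | (n + 2) => b (n + 2) * cfB a b (n + 1) + a (n + 2) * cfB a b n

/-- Two linearly independent families of good approximations with slowly growing denominators
bound how well `τ` can be approximated by rationals. -/
theorem exists_le_abs_sub_of_approximations {A B : ℕ → ℤ} {τ θ η : ℝ}
    (hθ : 0 < θ) (hη : 0 < η) (hB0 : ∀ n, 0 < B n) (hBm : Monotone B)
    (hBt : Tendsto (fun n => (B n : ℝ)) atTop atTop)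
    (hdet : ∀ n, A (n + 1) * B n - A n * B (n + 1) ≠ 0)
    (hR : ∀ᶠ n in atTop, |τ * B n - A n| ≤ (B (n + 1) : ℝ) ^ (-θ))
    (hgrow : ∀ᶠ n in atTop, (B (n + 1) : ℝ) ≤ (B n : ℝ) ^ η) :
    ∃ c > (0:ℝ), ∃ N₀ > (0:ℝ), ∀ M N : ℤ,
      (N : ℝ) ≥ N₀ → |τ - (M : ℝ) / (N : ℝ)| ≥ c / (N : ℝ) ^ (1 + η / θ) := by
  obtain ⟨n₀, hn₀⟩ := eventually_atTop.1 (hR.and hgrow)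
  have hBpos : ∀ n, (0:ℝ) < B n := fun n => by exact_mod_cast hB0 n
  have hBmono : ∀ {m n}, m ≤ n → (B m : ℝ) ≤ B n := fun h => by exact_mod_cast hBm h
  refine ⟨1 / (2 * 2 ^ (η / θ)), by positivity, (B (n₀ + 1) : ℝ) ^ θ, by
    have := hBpos (n₀ + 1); positivity, fun M N hN => ?_⟩
  have hN0 : (0:ℝ) < N := lt_of_lt_of_le (by have := hBpos (n₀ + 1); positivity) hN
  have hex : ∃ n, 2 * (N : ℝ) ≤ (B n : ℝ) ^ θ :=
    (((tendsto_rpow_atTop hθ).comp hBt).eventually_ge_atTop (2 * (N : ℝ))).exists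
  classical
  obtain ⟨n, hn, hnlt⟩ : ∃ n, 2 * (N : ℝ) ≤ (B (n + 1) : ℝ) ^ θ ∧
      n₀ ≤ n ∧ (B n : ℝ) ^ θ < 2 * N := by
    have h1 := Nat.find_spec hex
    have h2 : n₀ + 1 < Nat.find hex := by
      by_contra! h
      have := rpow_le_rpow (hBpos _).le (hBmono h) hθ.le
      linarith
    refine ⟨Nat.find hex - 1, ?_, by omega, ?_⟩
    · rwa [Nat.sub_add_cancel (by omega)]
    · exact not_le.1 (Nat.find_min hex (by omega))
  obtain ⟨hnn, hnlt⟩ := hnlt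
  have hBn : (B n : ℝ) ≤ (2 * N : ℝ) ^ (1 / θ) := by
    have := rpow_le_rpow (by have := hBpos n; positivity) hnlt.le (by positivity : 0 ≤ 1 / θ)
    rwa [← rpow_mul (hBpos n).le, mul_one_div_cancel hθ.ne', rpow_one] at this
  have hBn1 : (B (n + 1) : ℝ) ≤ (2 * N : ℝ) ^ (η / θ) := by
    refine ((hn₀ n hnn).2.trans (rpow_le_rpow (hBpos n).le hBn hη.le)).trans ?_
    rw [← rpow_mul (by positivity)]
    exact le_of_eq (by congr 1; ring)
  obtain ⟨m, hm1, hm2, hm3⟩ : ∃ m, n ≤ m ∧ m ≤ n + 1 ∧ N * A m - M * B m ≠ 0 := by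
    by_contra! h
    have e1 := h n le_rfl (by omega)
    have e2 := h (n + 1) (by omega) le_rfl
    have hNz : N ≠ 0 := by rintro rfl; simp at hN0
    apply hdet n
    apply mul_left_cancel₀ hNz
    linear_combination B n * e2 - B (n + 1) * e1
  have hm4 : (1:ℝ) ≤ |(N : ℝ) * A m - M * B m| := by
    exact_mod_cast Int.one_le_abs hm3
  have hRm : (N : ℝ) * |τ * B m - A m| ≤ 1 / 2 := by
    have h1 := (hn₀ m (hnn.trans hm1)).1
    have h2 : 2 * (N : ℝ) ≤ (B (m + 1) : ℝ) ^ θ :=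
      hn.trans (rpow_le_rpow (hBpos _).le (hBmono (by omega)) hθ.le)
    rw [rpow_neg (hBpos _).le] at h1
    calc (N : ℝ) * |τ * B m - A m| ≤ N * (2 * (N : ℝ))⁻¹ := by
          gcongr
          exact h1.trans (inv_anti₀ (by positivity) h2)
      _ = 1 / 2 := by field_simp
  have key : 1 / 2 ≤ (N : ℝ) * B m * |τ - M / N| := by
    have e : (N : ℝ) * B m * (τ - M / N) = (N * A m - M * B m) + N * (τ * B m - A m) := by
      field_simp; ring
    have h1 : |(N : ℝ) * B m * (τ - M / N)| = (N : ℝ) * B m * |τ - M / N| := by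
      rw [abs_mul, abs_of_pos (mul_pos hN0 (hBpos m))]
    have h2 : |(N : ℝ) * (τ * B m - A m)| = N * |τ * B m - A m| := by
      rw [abs_mul, abs_of_pos hN0]
    have h3 := abs_sub_abs_le_abs_add ((N : ℝ) * A m - M * B m) (N * (τ * B m - A m))
    rw [← e, h1, h2] at h3
    linarith
  have hBm' : (B m : ℝ) ≤ (2 * N : ℝ) ^ (η / θ) := (hBmono hm2).trans hBn1
  have key2 : 1 / 2 ≤ (N : ℝ) * (2 * N : ℝ) ^ (η / θ) * |τ - M / N| :=
    key.trans (by gcongr)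
  rw [ge_iff_le, rpow_add hN0, rpow_one, div_le_iff₀ (by positivity), div_le_iff₀ (by positivity)]
  rw [mul_rpow (by norm_num) hN0.le] at key2
  linarith

theorem irrational_of_exists_le_abs_sub {τ μ : ℝ}
    (h : ∃ c > (0:ℝ), ∃ N₀ > (0:ℝ), ∀ M N : ℤ,
      (N : ℝ) ≥ N₀ → |τ - (M : ℝ) / (N : ℝ)| ≥ c / (N : ℝ) ^ μ) : Irrational τ := by
  obtain ⟨c, hc, N₀, hN₀, H⟩ := h
  rintro ⟨q, rfl⟩
  obtain ⟨k, hk⟩ := exists_nat_gt N₀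
  have hk0 : (0:ℝ) < k := hN₀.trans hk
  have hd : (1:ℝ) ≤ q.den := by exact_mod_cast q.den_pos
  have hN : N₀ ≤ ((k * q.den : ℤ) : ℝ) := by
    push_cast
    nlinarith
  have := H (k * q.num) (k * q.den) hN
  have hpos : (0:ℝ) < ((k * q.den : ℤ) : ℝ) := hN₀.trans_le hN
  have e : (q : ℝ) - ((k * q.num : ℤ) : ℝ) / ((k * q.den : ℤ) : ℝ) = 0 := by
    have hq : (q : ℝ) = q.num / q.den := by exact_mod_cast (Rat.num_div_den q).symm
    rw [hq]
    push_cast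
    field_simp
    ring
  rw [e, abs_zero] at this
  have : 0 < c / ((k * q.den : ℤ) : ℝ) ^ μ := by positivity
  linarith

section Convergents

variable {a b : ℕ → ℤ}

theorem cfB_pos (ha0 : ∀ n, 1 ≤ n → 0 < a n) (hb0 : ∀ n, 1 ≤ n → 0 < b n) :
    ∀ n, 0 < cfB a b n
  | 0 => by simp [cfB]
  | 1 => by simpa [cfB] using hb0 1 le_rfl
  | n + 2 => by
    rw [cfB]
    have := mul_pos (hb0 (n + 2) (by omega)) (cfB_pos ha0 hb0 (n + 1))
    have := mul_pos (ha0 (n + 2) (by omega)) (cfB_pos ha0 hb0 n)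
    linarith

theorem mul_cfB_le_cfB_succ (ha0 : ∀ n, 1 ≤ n → 0 < a n) (hb0 : ∀ n, 1 ≤ n → 0 < b n) :
    ∀ n, b (n + 1) * cfB a b n ≤ cfB a b (n + 1)
  | 0 => by simp [cfB]
  | n + 1 => by
    rw [cfB]
    have := mul_pos (ha0 (n + 2) (by omega)) (cfB_pos ha0 hb0 n)
    linarith

theorem cfB_monotone (ha0 : ∀ n, 1 ≤ n → 0 < a n) (hb0 : ∀ n, 1 ≤ n → 0 < b n) :
    Monotone (cfB a b) := by
  refine monotone_nat_of_le_succ fun n => ?_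
  have := mul_cfB_le_cfB_succ ha0 hb0 n
  nlinarith [hb0 (n + 1) (by omega), cfB_pos ha0 hb0 n]

theorem cfB_succ_le (ha0 : ∀ n, 1 ≤ n → 0 < a n) (hb0 : ∀ n, 1 ≤ n → 0 < b n) :
    ∀ n, cfB a b (n + 1) ≤ (b (n + 1) + a (n + 1)) * cfB a b n
  | 0 => by simpa [cfB] using (ha0 1 le_rfl).le
  | n + 1 => by
    rw [cfB]
    have h1 := cfB_monotone ha0 hb0 (Nat.le_succ n)
    have h2 := mul_le_mul_of_nonneg_left h1 (ha0 (n + 2) (by omega)).le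
    rw [add_mul]
    simpa using h2

theorem cfA_mul_cfB_sub (a b : ℕ → ℤ) (n : ℕ) :
    cfA a b (n + 1) * cfB a b n - cfA a b n * cfB a b (n + 1) =
      (-1) ^ n * ∏ i ∈ Finset.range (n + 1), a (i + 1) := by
  induction n with
  | zero => simp [cfA, cfB]
  | succ n ih =>
    rw [Finset.prod_range_succ, pow_succ, cfA, cfB]
    linear_combination (-a (n + 2)) * ih

/-- The convergents are the partial sums of an alternating series with terms decreasing in absolute
value. -/
theorem exists_tendsto_cfA_div_cfB
    (ha0 : ∀ n, 1 ≤ n → 0 < a n) (hb0 : ∀ n, 1 ≤ n → 0 < b n)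
    (hlim : Tendsto (fun n => ((∏ i ∈ Finset.range n, a (i + 1) : ℤ) : ℝ) / cfB a b n)
      atTop (nhds 0)) :
    ∃ τ : ℝ, Tendsto (fun n => (cfA a b n : ℝ) / (cfB a b n : ℝ)) atTop (nhds τ) ∧
      ∀ n, |τ * cfB a b n - cfA a b n| ≤
        ((∏ i ∈ Finset.range (n + 1), a (i + 1) : ℤ) : ℝ) / cfB a b (n + 1) := by
  set P : ℕ → ℤ := fun n => ∏ i ∈ Finset.range n, a (i + 1) with hP
  have hP0 : ∀ n, (0:ℝ) < P n := fun n => by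
    exact_mod_cast Finset.prod_pos fun i _ => ha0 (i + 1) (by omega)
  have hB0 : ∀ n, (0:ℝ) < cfB a b n := fun n => by exact_mod_cast cfB_pos ha0 hb0 n
  set d : ℕ → ℝ := fun n => (P (n + 1) : ℝ) / (cfB a b n * cfB a b (n + 1)) with hd
  have hd0 : ∀ n, 0 < d n := fun n => div_pos (hP0 _) (mul_pos (hB0 _) (hB0 _))
  have hsum : ∀ n, ∑ i ∈ Finset.range n, (-1 : ℝ) ^ i * d i = cfA a b n / cfB a b n := by
    intro n
    induction n with
    | zero => simp [cfA]
    | succ n ih =>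
      rw [Finset.sum_range_succ, ih]
      have h := cfA_mul_cfB_sub a b n
      have h' : (cfA a b (n + 1) : ℝ) * cfB a b n - cfA a b n * cfB a b (n + 1) =
        (-1) ^ n * P (n + 1) := by exact_mod_cast h
      have h1 := (hB0 n).ne'
      have h2 := (hB0 (n + 1)).ne'
      simp only [hd]
      field_simp
      linear_combination -h'
  have hanti : Antitone d := by
    refine antitone_nat_of_succ_le fun n => ?_
    have e : (P (n + 2) : ℝ) = P (n + 1) * a (n + 2) := by
      simp only [hP]
      rw [Finset.prod_range_succ]
      push_cast
      ring
    have hB : (a (n + 2) : ℝ) * cfB a b n ≤ cfB a b (n + 2) := by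
      have : a (n + 2) * cfB a b n ≤ cfB a b (n + 2) := by
        rw [cfB]
        have := mul_pos (hb0 (n + 2) (by omega)) (cfB_pos ha0 hb0 (n + 1))
        linarith
      exact_mod_cast this
    simp only [hd]
    rw [div_le_div_iff₀ (mul_pos (hB0 _) (hB0 _)) (mul_pos (hB0 _) (hB0 _)), e]
    have := mul_le_mul_of_nonneg_left hB (mul_pos (hP0 (n + 1)) (hB0 (n + 1))).le
    linarith
  have hdlim : Tendsto d atTop (nhds 0) := by
    refine squeeze_zero (fun n => (hd0 n).le) (fun n => ?_)
      (hlim.comp (tendsto_add_atTop_nat 1))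
    simp only [hd, Function.comp]
    have : (1:ℝ) ≤ cfB a b n := by exact_mod_cast cfB_pos ha0 hb0 n
    have h1 := hB0 (n + 1)
    exact div_le_div_of_nonneg_left (hP0 _).le h1 (by nlinarith)
  obtain ⟨τ, hτ⟩ := hanti.tendsto_alternating_series_of_tendsto_zero hdlim
  refine ⟨τ, by simpa only [hsum] using hτ, fun n => ?_⟩
  have hdn : |τ - cfA a b n / cfB a b n| ≤ d n := by
    rw [← hsum, abs_le]
    obtain ⟨k, rfl | rfl⟩ := n.even_or_odd'
    · have h1 := hanti.alternating_series_le_tendsto hτ k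
      have h2 := hanti.tendsto_le_alternating_series hτ k
      rw [Finset.sum_range_succ, pow_mul] at h2
      simp only [even_two, Even.neg_pow, one_pow, one_mul] at h2
      have := hd0 (2 * k)
      constructor <;> linarith
    · have h1 := hanti.alternating_series_le_tendsto hτ (k + 1)
      have h2 := hanti.tendsto_le_alternating_series hτ k
      rw [show 2 * (k + 1) = 2 * k + 1 + 1 by ring, Finset.sum_range_succ, pow_succ, pow_mul] at h1
      simp only [even_two, Even.neg_pow, one_pow, one_mul] at h1
      have := hd0 (2 * k + 1)
      constructor <;> linarith
  have e : τ * cfB a b n - cfA a b n = cfB a b n * (τ - cfA a b n / cfB a b n) := by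
    have := (hB0 n).ne'
    field_simp
  rw [e, abs_mul, abs_of_pos (hB0 n)]
  calc (cfB a b n : ℝ) * |τ - cfA a b n / cfB a b n| ≤ cfB a b n * d n :=
        mul_le_mul_of_nonneg_left hdn (hB0 n).le
    _ = _ := by
        simp only [hd]
        have h1 := (hB0 n).ne'
        have h2 := (hB0 (n + 1)).ne'
        field_simp
        rfl

end Convergents

theorem eventually_mul_le_log_factorial (K : ℝ) :
    ∀ᶠ n : ℕ in atTop, K * n ≤ log (n.factorial : ℝ) := by
  filter_upwards [(FloorSemiring.tendsto_pow_div_factorial_atTop (exp K)).eventually_le_const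
    zero_lt_one] with n hn
  have hf : (0:ℝ) < n.factorial := by exact_mod_cast n.factorial_pos
  rw [div_le_one hf, ← exp_nat_mul] at hn
  rw [le_log_iff_exp_le hf, mul_comm]
  exact hn

section Growth

variable {a b : ℕ → ℤ} {l α β₁ β₂ k₁ k₂ : ℝ}

theorem log_prod_le (ha0 : ∀ n, 1 ≤ n → 0 < a n) (hα : 0 < α)
    (ha : ∀ n : ℕ, 1 ≤ n → (a n : ℝ) ≤ α * (n : ℝ) ^ l) (n : ℕ) :
    log ((∏ i ∈ Finset.range n, a (i + 1) : ℤ) : ℝ) ≤ log α * n + l * log (n.factorial : ℝ) := by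
  induction n with
  | zero => simp
  | succ n ih =>
    have hp : ((∏ i ∈ Finset.range n, a (i + 1) : ℤ) : ℝ) ≠ 0 := by
      exact_mod_cast (Finset.prod_pos fun i _ => ha0 (i + 1) (by omega)).ne'
    have hn : (0:ℝ) < (n + 1 : ℕ) := by positivity
    have hapos : (0:ℝ) < a (n + 1) := by exact_mod_cast ha0 (n + 1) (by omega)
    have h1 := log_le_log hapos (ha (n + 1) (by omega))
    rw [log_mul hα.ne' (by positivity), log_rpow hn] at h1
    rw [Finset.prod_range_succ, Int.cast_mul, log_mul hp hapos.ne', Nat.factorial_succ,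
      Nat.cast_mul, log_mul hn.ne' (by positivity)]
    push_cast at *
    linarith

theorem le_log_cfB (ha0 : ∀ n, 1 ≤ n → 0 < a n) (hb0 : ∀ n, 1 ≤ n → 0 < b n) (hβ₁ : 0 < β₁)
    (hb : ∀ n : ℕ, 1 ≤ n → β₁ * (n : ℝ) ^ k₁ ≤ (b n : ℝ)) (n : ℕ) :
    log β₁ * n + k₁ * log (n.factorial : ℝ) ≤ log (cfB a b n) := by
  induction n with
  | zero => simp [cfB]
  | succ n ih =>
    have hn : (0:ℝ) < (n + 1 : ℕ) := by positivity
    have hB : (0:ℝ) < cfB a b n := by exact_mod_cast cfB_pos ha0 hb0 n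
    have hbpos : (0:ℝ) < b (n + 1) := by exact_mod_cast hb0 (n + 1) (by omega)
    have h1 := log_le_log (by positivity) (hb (n + 1) (by omega))
    rw [log_mul hβ₁.ne' (by positivity), log_rpow hn] at h1
    have h2 : (b (n + 1) : ℝ) * cfB a b n ≤ cfB a b (n + 1) := by
      exact_mod_cast mul_cfB_le_cfB_succ ha0 hb0 n
    have h3 := log_le_log (by positivity) h2
    rw [log_mul hbpos.ne' hB.ne'] at h3
    rw [Nat.factorial_succ, Nat.cast_mul, log_mul hn.ne' (by positivity)]
    push_cast at *
    linarith

theorem eventually_mul_le_log_cfB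
    (ha0 : ∀ n, 1 ≤ n → 0 < a n) (hb0 : ∀ n, 1 ≤ n → 0 < b n) (hβ₁ : 0 < β₁) (hk₁ : 0 < k₁)
    (hb : ∀ n : ℕ, 1 ≤ n → β₁ * (n : ℝ) ^ k₁ ≤ (b n : ℝ)) (K : ℝ) :
    ∀ᶠ n : ℕ in atTop, K * n ≤ log (cfB a b n) := by
  filter_upwards [eventually_mul_le_log_factorial ((K - log β₁) / k₁)] with n hn
  have h1 := le_log_cfB ha0 hb0 hβ₁ hb n
  have h2 := mul_le_mul_of_nonneg_left hn hk₁.le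
  have e : k₁ * ((K - log β₁) / k₁ * n) = K * n - log β₁ * n := by field_simp
  linarith

theorem tendsto_cfB_atTop
    (ha0 : ∀ n, 1 ≤ n → 0 < a n) (hb0 : ∀ n, 1 ≤ n → 0 < b n) (hβ₁ : 0 < β₁) (hk₁ : 0 < k₁)
    (hb : ∀ n : ℕ, 1 ≤ n → β₁ * (n : ℝ) ^ k₁ ≤ (b n : ℝ)) :
    Tendsto (fun n => (cfB a b n : ℝ)) atTop atTop := by
  refine tendsto_atTop_mono' atTop ?_ tendsto_natCast_atTop_atTop
  filter_upwards [eventually_mul_le_log_cfB ha0 hb0 hβ₁ hk₁ hb 1] with n hn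
  have hB : (0:ℝ) < cfB a b n := by exact_mod_cast cfB_pos ha0 hb0 n
  linarith [log_le_sub_one_of_pos hB]

theorem eventually_prod_div_cfB_le
    (ha0 : ∀ n, 1 ≤ n → 0 < a n) (hb0 : ∀ n, 1 ≤ n → 0 < b n)
    (hl : 0 ≤ l) (hα : 0 < α) (hβ₁ : 0 < β₁) (hk₁ : 0 < k₁)
    (ha : ∀ n : ℕ, 1 ≤ n → (a n : ℝ) ≤ α * (n : ℝ) ^ l)
    (hb : ∀ n : ℕ, 1 ≤ n → β₁ * (n : ℝ) ^ k₁ ≤ (b n : ℝ)) {δ : ℝ} (hδ : 0 < δ) :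
    ∀ᶠ n : ℕ in atTop, ((∏ i ∈ Finset.range n, a (i + 1) : ℤ) : ℝ) / cfB a b n ≤
      (cfB a b n : ℝ) ^ (-(1 - l / k₁ - δ)) := by
  filter_upwards [eventually_mul_le_log_cfB ha0 hb0 hβ₁ hk₁ hb
    ((log α - l / k₁ * log β₁) / δ)] with n hn
  have hB : (0:ℝ) < cfB a b n := by exact_mod_cast cfB_pos ha0 hb0 n
  have hp : (0:ℝ) < ((∏ i ∈ Finset.range n, a (i + 1) : ℤ) : ℝ) := by
    exact_mod_cast Finset.prod_pos fun i _ => ha0 (i + 1) (by omega)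
  have h1 := log_prod_le ha0 hα ha n
  have h2 := mul_le_mul_of_nonneg_left (le_log_cfB ha0 hb0 hβ₁ hb n)
    (by positivity : 0 ≤ l / k₁)
  have h3 := mul_le_mul_of_nonneg_left hn hδ.le
  have e1 : l / k₁ * (k₁ * log (n.factorial : ℝ)) = l * log (n.factorial : ℝ) := by field_simp
  have e2 : δ * ((log α - l / k₁ * log β₁) / δ * n) = (log α - l / k₁ * log β₁) * n := by
    field_simp
  rw [← log_le_log_iff (by positivity) (by positivity), log_div hp.ne' hB.ne', log_rpow hB]
  rw [e2] at h3
  rw [mul_add, e1] at h2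
  linarith

theorem eventually_cfB_succ_le_rpow
    (ha0 : ∀ n, 1 ≤ n → 0 < a n) (hb0 : ∀ n, 1 ≤ n → 0 < b n)
    (hα : 0 < α) (hβ₁ : 0 < β₁) (hβ₂ : 0 < β₂) (hk₁ : 0 < k₁) (hk₂ : 0 < k₂) (hlk : l ≤ k₂)
    (ha : ∀ n : ℕ, 1 ≤ n → (a n : ℝ) ≤ α * (n : ℝ) ^ l)
    (hb : ∀ n : ℕ, 1 ≤ n → β₁ * (n : ℝ) ^ k₁ ≤ (b n : ℝ))
    (hb' : ∀ n : ℕ, 1 ≤ n → (b n : ℝ) ≤ β₂ * (n : ℝ) ^ k₂) {δ : ℝ} (hδ : 0 < δ) :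
    ∀ᶠ n : ℕ in atTop, (cfB a b (n + 1) : ℝ) ≤ (cfB a b n : ℝ) ^ (1 + δ) := by
  filter_upwards [eventually_mul_le_log_cfB ha0 hb0 hβ₁ hk₁ hb ((|log (β₂ + α)| + k₂) / δ),
    eventually_ge_atTop 1] with n hn hn1
  have hB : (0:ℝ) < cfB a b n := by exact_mod_cast cfB_pos ha0 hb0 n
  have hB' : (0:ℝ) < cfB a b (n + 1) := by exact_mod_cast cfB_pos ha0 hb0 (n + 1)
  have hx : (1:ℝ) ≤ (n + 1 : ℕ) := by push_cast; linarith [(Nat.cast_nonneg n : (0:ℝ) ≤ n)]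
  have h1 : (cfB a b (n + 1) : ℝ) ≤ (b (n + 1) + a (n + 1)) * cfB a b n := by
    exact_mod_cast cfB_succ_le ha0 hb0 n
  have h2 : (b (n + 1) + a (n + 1) : ℝ) ≤ (β₂ + α) * ((n + 1 : ℕ) : ℝ) ^ k₂ := by
    have := mul_le_mul_of_nonneg_left (rpow_le_rpow_of_exponent_le hx hlk) hα.le
    linarith [ha (n + 1) (by omega), hb' (n + 1) (by omega)]
  have h3 := h1.trans (mul_le_mul_of_nonneg_right h2 hB.le)
  have h4 := log_le_log hB' h3
  rw [log_mul (by positivity) hB.ne', log_mul (by positivity) (by positivity),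
    log_rpow (by positivity)] at h4
  have h5 : log ((n + 1 : ℕ) : ℝ) ≤ n := by
    have := log_le_sub_one_of_pos (by positivity : (0:ℝ) < (n + 1 : ℕ))
    push_cast at *
    linarith
  have h6 := mul_le_mul_of_nonneg_left hn hδ.le
  have e : δ * ((|log (β₂ + α)| + k₂) / δ * n) = |log (β₂ + α)| * n + k₂ * n := by field_simp
  have h7 : log (β₂ + α) ≤ |log (β₂ + α)| * n :=
    (le_abs_self _).trans (le_mul_of_one_le_right (abs_nonneg _) (by exact_mod_cast hn1))
  have h8 := mul_le_mul_of_nonneg_left h5 hk₂.le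
  rw [← log_le_log_iff hB' (by positivity), log_rpow hB]
  linarith

end Growth

/-- polynomial growth.  If `a_n ≤ α n^l` and
`β₁ n^{k₁} ≤ b_n ≤ β₂ n^{k₂}` with `0 ≤ l < k₁ ≤ k₂`, then the continued
fraction converges to an irrational `τ` with `μ_I(τ) ≤ 2 + l/(k₁ - l)`. -/
theorem gcf_muI_le_of_polynomial_growth
    (a b : ℕ → ℤ) (ha0 : ∀ n, 1 ≤ n → 0 < a n) (hb0 : ∀ n, 1 ≤ n → 0 < b n)
    (l α β₁ β₂ k₁ k₂ : ℝ)
    (hl : 0 ≤ l) (hα : 0 < α) (hβ₁ : 0 < β₁) (hβ₂ : 0 < β₂)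
    (hk₁ : 0 < k₁) (hk₂ : 0 < k₂) (hlk : l < k₁) (hkk : k₁ ≤ k₂)
    (ha : ∀ n : ℕ, 1 ≤ n → (a n : ℝ) ≤ α * (n : ℝ) ^ l)
    (hb : ∀ n : ℕ, 1 ≤ n → β₁ * (n : ℝ) ^ k₁ ≤ (b n : ℝ) ∧ (b n : ℝ) ≤ β₂ * (n : ℝ) ^ k₂) :
    ∃ τ : ℝ,
      Tendsto (fun n => (cfA a b n : ℝ) / (cfB a b n : ℝ)) atTop (nhds τ) ∧
      Irrational τ ∧
      muI τ ≤ ((2 + l / (k₁ - l) : ℝ) : EReal) := by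
  have hb' := fun n hn => (hb n hn).1
  have hb'' := fun n hn => (hb n hn).2
  have hθ₀ : 0 < 1 - l / k₁ := by
    rw [sub_pos, div_lt_one hk₁]
    exact hlk
  have hBt := tendsto_cfB_atTop ha0 hb0 hβ₁ hk₁ hb'
  have hP := fun {δ : ℝ} (hδ : 0 < δ) =>
    eventually_prod_div_cfB_le ha0 hb0 hl hα hβ₁ hk₁ ha hb' hδ
  have hlim : Tendsto (fun n => ((∏ i ∈ Finset.range n, a (i + 1) : ℤ) : ℝ) / cfB a b n)
      atTop (nhds 0) := by
    refine squeeze_zero' (.of_forall fun n => ?_) (hP (half_pos hθ₀))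
      ((tendsto_rpow_neg_atTop (by linarith)).comp hBt)
    have hB : (0:ℝ) < cfB a b n := by exact_mod_cast cfB_pos ha0 hb0 n
    have hp : (0:ℝ) < ((∏ i ∈ Finset.range n, a (i + 1) : ℤ) : ℝ) := by
      exact_mod_cast Finset.prod_pos fun i _ => ha0 (i + 1) (by omega)
    positivity
  obtain ⟨τ, hτ, hR⟩ := exists_tendsto_cfA_div_cfB ha0 hb0 hlim
  have hbound : ∀ δ : ℝ, 0 < δ → δ < 1 - l / k₁ → ∃ c > (0:ℝ), ∃ N₀ > (0:ℝ), ∀ M N : ℤ,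
      (N : ℝ) ≥ N₀ → |τ - (M : ℝ) / (N : ℝ)| ≥
        c / (N : ℝ) ^ (1 + (1 + δ) / (1 - l / k₁ - δ)) := by
    intro δ hδ hδ'
    refine exists_le_abs_sub_of_approximations (sub_pos.2 hδ') (by linarith)
      (cfB_pos ha0 hb0) (cfB_monotone ha0 hb0) hBt (A := cfA a b) (fun n => ?_) ?_
      (eventually_cfB_succ_le_rpow ha0 hb0 hα hβ₁ hβ₂ hk₁ hk₂ (hlk.le.trans hkk) ha hb' hb'' hδ)
    · rw [cfA_mul_cfB_sub]
      exact mul_ne_zero (by simp) (Finset.prod_pos fun i _ => ha0 (i + 1) (by omega)).ne'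
    · filter_upwards [(tendsto_add_atTop_nat 1).eventually (hP hδ)] with n hn
      exact (hR n).trans hn
  refine ⟨τ, hτ, irrational_of_exists_le_abs_sub
    (hbound ((1 - l / k₁) / 2) (half_pos hθ₀) (half_lt_self hθ₀)), ?_⟩
  have hcont : Tendsto (fun δ : ℝ => ((1 + (1 + δ) / (1 - l / k₁ - δ) : ℝ) : EReal))
      (nhdsWithin 0 (Set.Ioi 0)) (nhds ((2 + l / (k₁ - l) : ℝ) : EReal)) := by
    refine (continuous_coe_real_ereal.tendsto _).comp ?_
    have hc : ContinuousAt (fun δ : ℝ => 1 + (1 + δ) / (1 - l / k₁ - δ)) 0 := by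
      refine continuousAt_const.add (ContinuousAt.div (by fun_prop) (by fun_prop) ?_)
      simpa using hθ₀.ne'
    have e : 2 + l / (k₁ - l) = 1 + (1 + (0:ℝ)) / (1 - l / k₁ - 0) := by
      have h1 : k₁ - l ≠ 0 := (sub_pos.2 hlk).ne'
      have h2 : 1 - l / k₁ - 0 = (k₁ - l) / k₁ := by field_simp; ring
      rw [h2]
      field_simp
      ring
    rw [e]
    exact hc.tendsto.mono_left nhdsWithin_le_nhds
  refine ge_of_tendsto hcont ?_
  filter_upwards [Ioo_mem_nhdsGT hθ₀] with δ hδ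
  exact sInf_le ⟨_, hbound δ hδ.1 hδ.2, rfl⟩
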